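/- Forbidden configuration H₁: no locally optimal geometric graph G on ℤ² contains all five of the edges {(0,0),(−1,0)}, {(−1,0),(0,1)}, {(0,1),(1,0)}, {(1,0),(1,−1)}, {(1,−1),(0,0)} simultaneously. -/

import Mathlib

open SimpleGraph ENNReal

/-- The point of the Euclidean plane (identified with `ℂ`) corresponding to a lattice point. -/
noncomputable def toC (p : ℤ × ℤ) : ℂ := ⟨(p.1 : ℝ), (p.2 : ℝ)⟩

/-- The Euclidean length of a walk in a geometric graph on `ℤ²`:
the sum of the Euclidean lengths of its edges. -/
noncomputable def walkLen (G : SimpleGraph (ℤ × ℤ)) :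
    ∀ {p q : ℤ × ℤ}, G.Walk p q → ℝ
  | _, _, .nil => 0
  | p, _, .cons (v := v) _ w => dist (toC p) (toC v) + walkLen G w

/-- The graph distance `d_G(p,q)`: infimum of Euclidean lengths of walks from `p` to `q`
(`∞` if there is no walk). -/
noncomputable def gdist (G : SimpleGraph (ℤ × ℤ)) (p q : ℤ × ℤ) : ℝ≥0∞ :=
  ⨅ w : G.Walk p q, ENNReal.ofReal (walkLen G w)

/-- `G` has maximum degree at most `3`. -/
def MaxDegThree (G : SimpleGraph (ℤ × ℤ)) : Prop :=
  ∀ v : ℤ × ℤ, (G.neighborSet v).encard ≤ 3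

/-- `G` is plane: two distinct edges, viewed as closed segments in the plane,
intersect at most in a common endpoint. -/
def IsPlane (G : SimpleGraph (ℤ × ℤ)) : Prop :=
  ∀ a b c d : ℤ × ℤ, G.Adj a b → G.Adj c d → s(a, b) ≠ s(c, d) →
    ∀ x : ℂ, x ∈ segment ℝ (toC a) (toC b) → x ∈ segment ℝ (toC c) (toC d) →
      x ∈ ({toC a, toC b} : Set ℂ) ∧ x ∈ ({toC c, toC d} : Set ℂ)

/-- `G` is locally optimal. -/
def LocallyOptimal (G : SimpleGraph (ℤ × ℤ)) : Prop :=
  IsPlane G ∧ MaxDegThree G ∧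
    ∀ p q : ℤ × ℤ, dist (toC p) (toC q) ≤ Real.sqrt 5 →
      gdist G p q ≤ ENNReal.ofReal ((1 + Real.sqrt 2) * dist (toC p) (toC q))

/-- The dilation of `G`. -/
noncomputable def dil (G : SimpleGraph (ℤ × ℤ)) : ℝ≥0∞ :=
  ⨆ (p : ℤ × ℤ) (q : ℤ × ℤ) (_ : p ≠ q),
    gdist G p q / ENNReal.ofReal (dist (toC p) (toC q))

lemma toC_injective : Function.Injective toC := by
  rintro ⟨a, b⟩ ⟨c, d⟩ h
  simpa [toC, Complex.ext_iff] using h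

/-- The squared Euclidean distance of two lattice points. -/
def sqDist (p q : ℤ × ℤ) : ℕ :=
  (p.1 - q.1).natAbs * (p.1 - q.1).natAbs + (p.2 - q.2).natAbs * (p.2 - q.2).natAbs

lemma dist_toC (p q : ℤ × ℤ) : dist (toC p) (toC q) = √(sqDist p q) := by
  have h : (sqDist p q : ℤ) = (p.1 - q.1) ^ 2 + (p.2 - q.2) ^ 2 := by
    simp only [sqDist, Nat.cast_add, Nat.cast_mul, Int.natCast_natAbs, abs_mul_abs_self, pow_two]
  have h' : (sqDist p q : ℝ) = ((p.1 : ℝ) - q.1) ^ 2 + ((p.2 : ℝ) - q.2) ^ 2 := by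
    exact_mod_cast h
  rw [Complex.dist_eq_re_im, h']
  rfl

section Walks

variable {G : SimpleGraph (ℤ × ℤ)}

lemma walkLen_cons {p q r : ℤ × ℤ} (h : G.Adj p q) (w : G.Walk q r) :
    walkLen G (Walk.cons h w) = dist (toC p) (toC q) + walkLen G w := rfl

lemma walkLen_nonneg {p q : ℤ × ℤ} (w : G.Walk p q) : 0 ≤ walkLen G w := by
  induction w with
  | nil => exact le_rfl
  | cons h w ih => rw [walkLen_cons]; positivity

lemma dist_le_walkLen {p q : ℤ × ℤ} (w : G.Walk p q) : dist (toC p) (toC q) ≤ walkLen G w := by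
  induction w with
  | nil => simp [walkLen]
  | cons h w ih => exact (dist_triangle _ _ _).trans (by rw [walkLen_cons]; gcongr)

lemma walkLen_append {p q r : ℤ × ℤ} (w : G.Walk p q) (w' : G.Walk q r) :
    walkLen G (w.append w') = walkLen G w + walkLen G w' := by
  induction w with
  | nil => simp [walkLen]
  | cons h w ih => rw [Walk.cons_append, walkLen_cons, walkLen_cons, ih, add_assoc]

lemma walkLen_dropUntil_le {p q u : ℤ × ℤ} (w : G.Walk p q) (h : u ∈ w.support) :
    walkLen G (w.dropUntil u h) ≤ walkLen G w := by
  conv_rhs => rw [← w.take_spec h, walkLen_append]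
  linarith [walkLen_nonneg (w.takeUntil u h)]

lemma walkLen_bypass_le {p q : ℤ × ℤ} (w : G.Walk p q) : walkLen G w.bypass ≤ walkLen G w := by
  induction w with
  | nil => exact le_rfl
  | cons h w ih =>
    rw [Walk.bypass, walkLen_cons]
    split_ifs with hs
    · exact (walkLen_dropUntil_le _ hs).trans (ih.trans (le_add_of_nonneg_left dist_nonneg))
    · rw [walkLen_cons]
      gcongr

/-- If `d_G(p,q)` is smaller than `L`, then some path from `p` to `q` is shorter than `L`. -/
lemma exists_isPath_walkLen_lt {p q : ℤ × ℤ} {L : ℝ} (h : gdist G p q < ENNReal.ofReal L) :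
    ∃ w : G.Walk p q, w.IsPath ∧ walkLen G w < L := by
  obtain ⟨w, hw⟩ := iInf_lt_iff.1 h
  refine ⟨w.bypass, w.bypass_isPath, (walkLen_bypass_le w).trans_lt ?_⟩
  exact (ENNReal.ofReal_lt_ofReal_iff_of_nonneg (walkLen_nonneg w)).1 hw

end Walks

/-- Twice the signed area of a lattice triangle. -/
def orient (a b c : ℤ × ℤ) : ℤ :=
  (b.1 - a.1) * (c.2 - a.2) - (b.2 - a.2) * (c.1 - a.1)

/-- The segments `ab` and `cd` cross at a point interior to both. -/
def crosses (a b c d : ℤ × ℤ) : Bool :=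
  orient a b c * orient a b d < 0 && orient c d a * orient c d b < 0

lemma IsPlane.eq_of_mem_openSegment {G : SimpleGraph (ℤ × ℤ)} (hG : IsPlane G)
    {a b c d : ℤ × ℤ} (hab : G.Adj a b) (hcd : G.Adj c d) {x : ℂ}
    (hx : x ∈ openSegment ℝ (toC a) (toC b)) (hx' : x ∈ segment ℝ (toC c) (toC d)) :
    s(a, b) = s(c, d) := by
  by_contra hne
  rcases (hG a b c d hab hcd hne x (openSegment_subset_segment _ _ _ hx) hx').1 with rfl | rfl
  · exact hab.ne (toC_injective (left_mem_openSegment_iff.1 hx))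
  · exact hab.ne (toC_injective (right_mem_openSegment_iff.1 hx))

lemma sub_ne_zero_of_mul_neg {x y : ℝ} (h : x * y < 0) : x - y ≠ 0 := by
  intro h'
  rw [sub_eq_zero.1 h'] at h
  exact (mul_self_nonneg y).not_gt h

lemma div_sub_mem_openSegment {x y : ℝ} (h : x * y < 0) (p q : ℤ × ℤ) :
    (⟨(x * q.1 - y * p.1) / (x - y), (x * q.2 - y * p.2) / (x - y)⟩ : ℂ) ∈
      openSegment ℝ (toC p) (toC q) := by
  refine ⟨-y / (x - y), x / (x - y), ?_, ?_, ?_, ?_⟩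
  · rcases mul_neg_iff.1 h with h | h
    · exact div_pos (by linarith) (by linarith)
    · exact div_pos_of_neg_of_neg (by linarith) (by linarith)
  · rcases mul_neg_iff.1 h with h | h
    · exact div_pos (by linarith) (by linarith)
    · exact div_pos_of_neg_of_neg (by linarith) (by linarith)
  · rw [← add_div, neg_add_eq_sub, div_self (sub_ne_zero_of_mul_neg h)]
  · apply Complex.ext <;>
      simp only [toC, Complex.add_re, Complex.add_im, Complex.smul_re, Complex.smul_im,
        smul_eq_mul] <;>
      ring

lemma IsPlane.crosses_eq_false {G : SimpleGraph (ℤ × ℤ)} (hG : IsPlane G) {a b c d : ℤ × ℤ}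
    (hab : G.Adj a b) (hcd : G.Adj c d) : crosses a b c d = false := by
  by_contra h
  simp only [crosses, Bool.not_eq_false, Bool.and_eq_true, decide_eq_true_eq] at h
  obtain ⟨h₁, h₂⟩ := h
  have h₁' : (orient a b c : ℝ) * orient a b d < 0 := by exact_mod_cast h₁
  have h₂' : (orient c d a : ℝ) * orient c d b < 0 := by exact_mod_cast h₂
  have hx := openSegment_subset_segment _ _ _ (div_sub_mem_openSegment h₁' c d)
  have hx' := div_sub_mem_openSegment h₂' a b
  have heq := hG.eq_of_mem_openSegment hab hcd hx' (by
    convert hx using 2 <;> rw [div_eq_div_iff (sub_ne_zero_of_mul_neg h₂')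
      (sub_ne_zero_of_mul_neg h₁')] <;> simp only [orient] <;> push_cast <;> ring)
  rcases Sym2.eq_iff.1 heq with ⟨rfl, rfl⟩ | ⟨rfl, rfl⟩ <;> simp [orient] at h₁

lemma exists_adj_of_gdist_ne_top {G : SimpleGraph (ℤ × ℤ)} {p q : ℤ × ℤ} (hpq : p ≠ q)
    (h : gdist G p q ≠ ⊤) : ∃ x, G.Adj p x := by
  obtain ⟨w, -⟩ := iInf_lt_iff.1 (lt_top_iff_ne_top.2 h)
  cases w with
  | nil => exact absurd rfl hpq
  | cons h w => exact ⟨_, h⟩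

lemma LocallyOptimal.exists_adj {G : SimpleGraph (ℤ × ℤ)} (hG : LocallyOptimal G) (p : ℤ × ℤ) :
    ∃ x, G.Adj p x := by
  refine exists_adj_of_gdist_ne_top (q := (p.1 + 1, p.2)) (by simp [Prod.ext_iff]) ?_
  refine ne_top_of_le_ne_top ENNReal.ofReal_ne_top (hG.2.2 _ _ ?_)
  rw [dist_toC]
  exact Real.sqrt_le_sqrt (by norm_num [sqDist])

/-- The edges of a locally optimal graph contain no lattice points in their interior. -/
lemma LocallyOptimal.gcd_eq_one {G : SimpleGraph (ℤ × ℤ)} (hG : LocallyOptimal G) {u v : ℤ × ℤ}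
    (h : G.Adj u v) : Int.gcd (v.1 - u.1) (v.2 - u.2) = 1 := by
  by_contra hg
  obtain ⟨x, hx⟩ := Int.gcd_dvd_left (v.1 - u.1) (v.2 - u.2)
  obtain ⟨y, hy⟩ := Int.gcd_dvd_right (v.1 - u.1) (v.2 - u.2)
  set g := Int.gcd (v.1 - u.1) (v.2 - u.2) with hg_def
  have hg₀ : g ≠ 0 := by
    intro h₀
    rw [hg_def, Int.gcd_eq_zero_iff, sub_eq_zero, sub_eq_zero] at h₀
    exact h.ne (Prod.ext h₀.1.symm h₀.2.symm)
  have hg₁ : (1 : ℝ) < g := by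
    exact_mod_cast (by omega : 1 < g)
  have hx' : (v.1 : ℝ) - u.1 = g * x := by exact_mod_cast hx
  have hy' : (v.2 : ℝ) - u.2 = g * y := by exact_mod_cast hy
  have hm : toC (u.1 + x, u.2 + y) ∈ openSegment ℝ (toC u) (toC v) := by
    refine ⟨1 - 1 / g, 1 / g, ?_, by positivity, by ring, ?_⟩
    · rw [sub_pos, div_lt_one (by linarith)]
      exact hg₁
    · apply Complex.ext
      · simp [toC]
        field_simp
        linarith
      · simp [toC]
        field_simp
        linarith
  obtain ⟨z, hz⟩ := hG.exists_adj (u.1 + x, u.2 + y)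
  rcases Sym2.eq_iff.1 (hG.1.eq_of_mem_openSegment h hz hm (left_mem_segment _ _ _)) with
    ⟨h', -⟩ | ⟨-, h'⟩
  · rw [← h', left_mem_openSegment_iff] at hm
    exact h.ne (toC_injective hm)
  · rw [← h', right_mem_openSegment_iff] at hm
    exact h.ne (toC_injective hm)

/-- A finite list of edges. -/
abbrev EdgeList := List ((ℤ × ℤ) × (ℤ × ℤ))

/-- All edges in the list `E` belong to `G`. -/
def EdgeList.In (E : EdgeList) (G : SimpleGraph (ℤ × ℤ)) : Prop := ∀ e ∈ E, G.Adj e.1 e.2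

/-- The neighbors of `u` along the edges in `E`. -/
def nbrs (E : EdgeList) (u : ℤ × ℤ) : List (ℤ × ℤ) :=
  E.filterMap fun e => if e.1 = u then some e.2 else if e.2 = u then some e.1 else none

/-- Adding the edge `uv` to `E` violates planarity or the degree bound. -/
def clash (E : EdgeList) (u v : ℤ × ℤ) : Bool :=
  3 < (v :: nbrs E u).dedup.length || 3 < (u :: nbrs E v).dedup.length ||
    E.any fun e => crosses e.1 e.2 u v

/-- A lower bound for `100 * √n`. -/
def weight (n : ℕ) : ℕ :=
  if n < 2 then 100 * n else if n < 5 then 141 else if n < 10 then 223 else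
    if n < 13 then 316 else 360

/-- The primitive vectors with coordinates between `-5` and `5`, with their weights. -/
def steps : List ((ℤ × ℤ) × ℕ) :=
  let I := [0, 1, -1, 2, -2, 3, -3, 4, -4, 5, -5]
  ((I ×ˢ I).filter fun d : ℤ × ℤ => Int.gcd d.1 d.2 = 1).map fun d => (d, weight (sqDist d (0, 0)))

/-- The possible next vertices, with the remaining budgets, of a walk from `u` to `q` with
length at most `r / 100`. -/
def moves (u q : ℤ × ℤ) (r : ℕ) : List ((ℤ × ℤ) × ℕ) :=
  ((steps.filter fun d => d.2 ≤ r).map fun d => ((u.1 + d.1.1, u.2 + d.1.2), r - d.2)).filter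
    fun m => 10000 * sqDist m.1 q ≤ m.2 * m.2

/-- For every path from `u` to `q` of length at most `r / 100` that avoids `S`, adding its edges
to `E` leads to a clash or to an edge list refuted by `k`. -/
def refutePaths (k : EdgeList → Bool) (q : ℤ × ℤ) :
    ℕ → List (ℤ × ℤ) → ℤ × ℤ → ℕ → EdgeList → Bool
  | 0, _, _, _, _ => false
  | n + 1, S, u, r, E =>
    if u = q then k E else (moves u q r).all fun (v, s) =>
      v ∈ S ||
        if v ∈ nbrs E u then refutePaths k q n (u :: S) v s E
        else clash E u v || refutePaths k q n (u :: S) v s ((u, v) :: E)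

/-- Some walk from `u` to `q` along at most `n` edges in `E` has weight at most `r`. -/
def linked (E : EdgeList) (q : ℤ × ℤ) : ℕ → ℤ × ℤ → ℕ → Bool
  | 0, u, _ => u = q
  | n + 1, u, r => u = q || (nbrs E u).any fun v =>
      weight (sqDist u v) ≤ r && linked E q n v (r - weight (sqDist u v))

/-- A strict upper bound for `100 * (1 + √2) * √n`, for `n ≤ 5`. -/
def budget (n : ℕ) : ℕ := if n < 2 then 245 else if n < 3 then 345 else 541

/-- Exhaustive search showing that no locally optimal graph contains the edges in `E`, branching
successively over the short paths between the pairs in `L`. Pairs already joined by a short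
path in `E` are skipped. -/
def refute : List ((ℤ × ℤ) × (ℤ × ℤ)) → EdgeList → Bool
  | [], _ => false
  | (p, q) :: L, E =>
    if linked E q 5 p (budget (sqDist p q)) then refute L E
    else refutePaths (refute L) q 6 [] p (budget (sqDist p q)) E

lemma EdgeList.In.adj_of_mem_nbrs {G : SimpleGraph (ℤ × ℤ)} {E : EdgeList} (hE : E.In G)
    {u v : ℤ × ℤ} (h : v ∈ nbrs E u) : G.Adj u v := by
  obtain ⟨e, he, h⟩ := List.mem_filterMap.1 h
  have := hE e he
  split_ifs at h with h₁ h₂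
  · simp_all
  · simp_all [G.adj_comm]

lemma MaxDegThree.length_dedup_le {G : SimpleGraph (ℤ × ℤ)} (hG : MaxDegThree G) {u : ℤ × ℤ}
    {l : List (ℤ × ℤ)} (hl : ∀ v ∈ l, G.Adj u v) : l.dedup.length ≤ 3 := by
  rw [← List.card_toFinset]
  have h : ((l.toFinset : Set (ℤ × ℤ))).encard ≤ 3 :=
    (Set.encard_le_encard fun v hv => hl v (by simpa using hv)).trans (hG u)
  rw [Set.encard_coe_eq_coe_finsetCard] at h
  exact_mod_cast h

lemma LocallyOptimal.clash_eq_false {G : SimpleGraph (ℤ × ℤ)} (hG : LocallyOptimal G)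
    {E : EdgeList} (hE : E.In G) {u v : ℤ × ℤ} (huv : G.Adj u v) : clash E u v = false := by
  have hu := hG.2.1.length_dedup_le (u := u) (l := v :: nbrs E u)
    (List.forall_mem_cons.2 ⟨huv, fun _ => hE.adj_of_mem_nbrs⟩)
  have hv := hG.2.1.length_dedup_le (u := v) (l := u :: nbrs E v)
    (List.forall_mem_cons.2 ⟨huv.symm, fun _ => hE.adj_of_mem_nbrs⟩)
  simp only [clash, Bool.or_eq_false_iff, decide_eq_false_iff_not, not_lt, List.any_eq_false,
    Bool.not_eq_true]
  exact ⟨⟨hu, hv⟩, fun e he => hG.1.crosses_eq_false (hE e he) huv⟩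

lemma weight_le (p q : ℤ × ℤ) : weight (sqDist p q) ≤ 100 * dist (toC p) (toC q) := by
  have h : ∀ n, weight n * weight n ≤ 10000 * n := by
    intro n
    unfold weight
    split_ifs with h₁
    · interval_cases n <;> norm_num
    all_goals omega
  rw [dist_toC, ← div_le_iff₀' (by norm_num)]
  refine Real.le_sqrt_of_sq_le ?_
  have := h (sqDist p q)
  rify at this
  nlinarith

lemma mem_steps {d : ℤ × ℤ} (h : Int.gcd d.1 d.2 = 1) (h₁ : |d.1| ≤ 5) (h₂ : |d.2| ≤ 5) :
    (d, weight (sqDist d (0, 0))) ∈ steps := by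
  rw [abs_le] at h₁ h₂
  refine List.mem_map_of_mem (List.mem_filter.2 ⟨List.mem_product.2 ⟨?_, ?_⟩, by simpa using h⟩)
  all_goals
    simp only [List.mem_cons, List.not_mem_nil, or_false]
    omega

/-- The first step of a short walk occurs in `moves`. -/
lemma LocallyOptimal.mem_moves {G : SimpleGraph (ℤ × ℤ)} (hG : LocallyOptimal G) {u v q : ℤ × ℤ}
    (huv : G.Adj u v) (w : G.Walk v q) {r : ℕ} (hr : r ≤ 541)
    (hw : 100 * walkLen G (Walk.cons huv w) ≤ r) :
    ∃ s ≤ r, (v, s) ∈ moves u q r ∧ 100 * walkLen G w ≤ s := by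
  rw [walkLen_cons] at hw
  have hr' : (r : ℝ) ≤ 541 := by exact_mod_cast hr
  have hsq : (sqDist u v : ℝ) = dist (toC u) (toC v) ^ 2 := by
    rw [dist_toC, Real.sq_sqrt (Nat.cast_nonneg _)]
  have hlt : sqDist u v < 30 := by
    have : (sqDist u v : ℝ) < 30 := by
      nlinarith [walkLen_nonneg w, dist_nonneg (x := toC u) (y := toC v)]
    exact_mod_cast this
  have hd : sqDist (v.1 - u.1, v.2 - u.2) (0, 0) = sqDist u v := by
    simp only [sqDist, sub_zero]
    rw [← Int.natAbs_neg (u.1 - v.1), ← Int.natAbs_neg (u.2 - v.2), neg_sub, neg_sub]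
  have hlt' : (v.1 - u.1).natAbs * (v.1 - u.1).natAbs +
      (v.2 - u.2).natAbs * (v.2 - u.2).natAbs < 30 := by
    simpa only [sqDist, sub_zero] using hd.trans_lt hlt
  have hwt := weight_le u v
  have hwr : weight (sqDist u v) ≤ r := by
    have : (weight (sqDist u v) : ℝ) ≤ r := by linarith [walkLen_nonneg w]
    exact_mod_cast this
  have hws : 100 * walkLen G w ≤ (r - weight (sqDist u v) : ℕ) := by
    rw [Nat.cast_sub hwr]
    linarith
  have habs : ∀ z : ℤ, z.natAbs * z.natAbs < 30 → |z| ≤ 5 := by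
    intro z hz
    have : z.natAbs < 6 := by nlinarith
    rw [abs_le]
    omega
  have hmem := mem_steps (d := (v.1 - u.1, v.2 - u.2)) (hG.gcd_eq_one huv)
    (habs _ ((Nat.le_add_right _ _).trans_lt hlt')) (habs _ ((Nat.le_add_left _ _).trans_lt hlt'))
  rw [hd] at hmem
  refine ⟨r - weight (sqDist u v), Nat.sub_le _ _, List.mem_filter.2 ⟨List.mem_map.2
    ⟨_, List.mem_filter.2 ⟨hmem, by simpa using hwr⟩, by simp⟩, ?_⟩, hws⟩
  have hq := (mul_le_mul_of_nonneg_left (dist_le_walkLen w) (by norm_num)).trans hws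
  have hq' : (10000 : ℝ) * sqDist v q =
      (100 * dist (toC v) (toC q)) * (100 * dist (toC v) (toC q)) := by
    rw [dist_toC, mul_mul_mul_comm, Real.mul_self_sqrt (Nat.cast_nonneg _)]
    norm_num
  have := mul_self_le_mul_self (by positivity) hq
  rw [← hq'] at this
  simp only [decide_eq_true_eq]
  exact_mod_cast this

lemma LocallyOptimal.not_in_of_refutePaths {G : SimpleGraph (ℤ × ℤ)} (hG : LocallyOptimal G)
    {k : EdgeList → Bool} {q : ℤ × ℤ} (hk : ∀ E, k E → ¬ E.In G) (n : ℕ) (S : List (ℤ × ℤ))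
    (u : ℤ × ℤ) (r : ℕ) (E : EdgeList) (h : refutePaths k q n S u r E) (w : G.Walk u q)
    (hp : w.IsPath) (hS : ∀ x ∈ S, x ∉ w.support) (hr : r ≤ 541) (hw : 100 * walkLen G w ≤ r) :
    ¬ E.In G := by
  induction n generalizing S u r E with
  | zero => simp [refutePaths] at h
  | succ n ih =>
    intro hE
    rw [refutePaths] at h
    cases w with
    | nil => exact hk E (by simpa using h) hE
    | @cons _ v _ huv w =>
      rw [Walk.cons_isPath_iff] at hp
      simp only [Walk.support_cons, List.mem_cons, not_or] at hS
      rw [if_neg fun huq : u = q => hp.2 (huq ▸ w.end_mem_support)] at h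
      obtain ⟨s, hsr, hs, hws⟩ := hG.mem_moves huv w hr hw
      have h := List.all_eq_true.1 h _ hs
      have hv : v ∉ S := fun hv => (hS v hv).2 w.start_mem_support
      have hS' : ∀ x ∈ u :: S, x ∉ w.support :=
        List.forall_mem_cons.2 ⟨hp.2, fun x hx => (hS x hx).2⟩
      simp only [hv, decide_false, Bool.false_or, hG.clash_eq_false hE huv] at h
      split_ifs at h with hn
      · exact ih _ _ _ _ h w hp.1 hS' (hsr.trans hr) hws hE
      · exact ih _ _ _ _ h w hp.1 hS' (hsr.trans hr) hws (List.forall_mem_cons.2 ⟨huv, hE⟩)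

lemma LocallyOptimal.exists_path {G : SimpleGraph (ℤ × ℤ)} (hG : LocallyOptimal G) {p q : ℤ × ℤ}
    (h : sqDist p q ≤ 5) :
    ∃ w : G.Walk p q, w.IsPath ∧ 100 * walkLen G w ≤ budget (sqDist p q) := by
  have hsqrt : dist (toC p) (toC q) ≤ √5 := by
    rw [dist_toC]
    exact Real.sqrt_le_sqrt (by exact_mod_cast h)
  have hb : (1 + √2) * dist (toC p) (toC q) < budget (sqDist p q) / 100 := by
    have h2 : √2 < 1.4143 := by
      rw [Real.sqrt_lt' (by norm_num)]
      norm_num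
    have h5 : √5 < 2.2361 := by
      rw [Real.sqrt_lt' (by norm_num)]
      norm_num
    have h2' := Real.sqrt_nonneg 2
    unfold budget
    split_ifs with h₁ h₃
    · have : dist (toC p) (toC q) ≤ 1 := by
        rw [dist_toC, Real.sqrt_le_one]
        exact_mod_cast Nat.le_of_lt_succ h₁
      push_cast
      nlinarith
    · have : dist (toC p) (toC q) ≤ √2 := by
        rw [dist_toC]
        exact Real.sqrt_le_sqrt (by exact_mod_cast Nat.le_of_lt_succ h₃)
      push_cast
      nlinarith
    · push_cast
      nlinarith
  have hpos : (0 : ℝ) < budget (sqDist p q) / 100 := lt_of_le_of_lt (by positivity) hb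
  obtain ⟨w, hp, hw⟩ := exists_isPath_walkLen_lt
    ((hG.2.2 p q hsqrt).trans_lt ((ENNReal.ofReal_lt_ofReal_iff hpos).2 hb))
  exact ⟨w, hp, by linarith⟩

lemma LocallyOptimal.not_in_of_refute {G : SimpleGraph (ℤ × ℤ)} (hG : LocallyOptimal G)
    (L : List ((ℤ × ℤ) × (ℤ × ℤ))) (hL : ∀ c ∈ L, sqDist c.1 c.2 ≤ 5) (E : EdgeList)
    (h : refute L E) : ¬ E.In G := by
  induction L generalizing E with
  | nil => simp [refute] at h
  | cons c L ih =>
    obtain ⟨p, q⟩ := c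
    rw [List.forall_mem_cons] at hL
    rw [refute] at h
    split_ifs at h
    · exact ih hL.2 E h
    · obtain ⟨w, hp, hw⟩ := hG.exists_path hL.1
      refine hG.not_in_of_refutePaths (ih hL.2) _ _ _ _ _ h w hp (by simp) ?_ hw
      unfold budget
      split_ifs <;> norm_num

/-- Forbidden configuration H₁: no locally optimal graph contains all five listed edges. -/
theorem forbidden_H1 (G : SimpleGraph (ℤ × ℤ)) (hG : LocallyOptimal G) :
    ¬ (G.Adj (0, 0) (-1, 0) ∧ G.Adj (-1, 0) (0, 1) ∧ G.Adj (0, 1) (1, 0) ∧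
        G.Adj (1, 0) (1, -1) ∧ G.Adj (1, -1) (0, 0)) := by
  rintro ⟨h₁, h₂, h₃, h₄, h₅⟩
  refine hG.not_in_of_refute
    [((0, 1), (0, 2)), ((0, 0), (1, 1)), ((-1, 1), (-1, 0)), ((0, 1), (-1, 1)),
      ((-1, 0), (-2, 0)), ((-1, 0), (-1, -1)), ((0, -1), (1, -1)), ((0, -1), (1, 1)),
      ((1, -1), (2, -1)), ((1, 0), (2, 0)), ((1, -1), (1, -2)), ((0, 0), (2, 1)),
      ((0, 0), (1, 2)), ((-1, 0), (-2, 1)), ((1, -2), (1, -3)), ((2, 0), (2, -1)),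
      ((2, -1), (3, -1)), ((0, 2), (-1, 2)), ((0, 1), (-1, 3)), ((0, 1), (-2, 2))]
    (by decide)
    [((0, 0), (-1, 0)), ((-1, 0), (0, 1)), ((0, 1), (1, 0)), ((1, 0), (1, -1)),
      ((1, -1), (0, 0))]
    (by decide +kernel) ?_
  simp [EdgeList.In, h₁, h₂, h₃, h₄, h₅]
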